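/- arXiv:2206.10278 — 4 statements merged into one kernel-verified Lean document; each statement's English description precedes it below -/
import Mathlib

section
/- For n ≥ 5, if det(E(W_n)) is given by the recurrence det(E(W_n)) = −(n−1)²·det(T_{n-2}) + 6(n−1)·det(B_{n-1}), where T_m is the m×m tridiagonal matrix with all nonzero entries −2 and B_m = [[0, e'],[e, T_{m-1}]], then this identity holds for the eccentricity matrix of the wheel graph W_n. -/
open Matrix

noncomputable section

/-- Tridiagonal matrix of order `m` with `a` on the diagonal, `b` on the superdiagonal
and `c` on the subdiagonal. -/
def tridiag {R : Type*} [Zero R] (m : ℕ) (a b c : R) : Matrix (Fin m) (Fin m) R :=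
  Matrix.of fun i j =>
    if (i : ℕ) = (j : ℕ) then a
    else if (j : ℕ) = (i : ℕ) + 1 then b
    else if (i : ℕ) = (j : ℕ) + 1 then c
    else 0

/-- The bordered matrix `[[0, e'],[e, A]]` where `e` is the all-ones vector. -/
def border {R : Type*} [Zero R] [One R] {m : ℕ} (A : Matrix (Fin m) (Fin m) R) :
    Matrix (Fin (m + 1)) (Fin (m + 1)) R :=
  Matrix.of fun i j =>
    if hi : i = 0 then (if j = 0 then 0 else 1)
    else if hj : j = 0 then 1
    else A (i.pred hi) (j.pred hj)

/-- The circulant matrix whose first row is `c`, each subsequent row the cyclic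
right shift of the previous one. -/
def circ {R : Type*} {m : ℕ} (c : Fin m → R) : Matrix (Fin m) (Fin m) R :=
  Matrix.of fun i j => c (j - i)

/-- The eccentricity matrix of the wheel graph `W_n` (hub is vertex `0`, cycle vertices
`1, …, n-1`): `E(W_n) = [[0, e'],[e, circ(0,0,2,…,2,0)]]`. -/
def EW (n : ℕ) : Matrix (Fin n) (Fin n) ℝ :=
  Matrix.of fun i j =>
    if i = j then 0
    else if (i : ℕ) = 0 ∨ (j : ℕ) = 0 then 1
    else if ((j : ℕ) : ZMod (n - 1)) - ((i : ℕ) : ZMod (n - 1)) = 1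
            ∨ ((i : ℕ) : ZMod (n - 1)) - ((j : ℕ) : ZMod (n - 1)) = 1 then 0
    else 2

section Border

variable {R : Type*} [CommRing R]

@[simp]
theorem border_zero_zero {m : ℕ} (A : Matrix (Fin m) (Fin m) R) : border A 0 0 = 0 := by
  simp [border]

@[simp]
theorem border_zero_succ {m : ℕ} (A : Matrix (Fin m) (Fin m) R) (j : Fin m) :
    border A 0 j.succ = 1 := by
  simp [border]

@[simp]
theorem border_succ_zero {m : ℕ} (A : Matrix (Fin m) (Fin m) R) (i : Fin m) :
    border A i.succ 0 = 1 := by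
  simp [border]

@[simp]
theorem border_succ_succ {m : ℕ} (A : Matrix (Fin m) (Fin m) R) (i j : Fin m) :
    border A i.succ j.succ = A i j := by
  simp [border]

/-- Replacing the first row of a bordered matrix by `(k, s, …, s)`. -/
theorem det_updateRow_zero_border {m : ℕ} (D : Matrix (Fin m) (Fin m) R) (k s : R) :
    ((border D).updateRow 0 (Fin.cons k fun _ => s)).det = k * D.det + s * (border D).det := by
  have hrow : (Fin.cons k fun _ => s : Fin (m + 1) → R)
      = k • (Pi.single 0 1) + s • (border D) 0 := by
    ext j
    refine Fin.cases ?_ (fun j => ?_) j <;> simp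
  rw [hrow, det_updateRow_add, det_updateRow_smul, det_updateRow_smul, updateRow_eq_self,
    det_succ_row_zero, Fin.sum_univ_succ]
  have hsub : ((border D).updateRow 0 (Pi.single 0 1)).submatrix Fin.succ (Fin.succAbove 0)
      = D := by
    ext i j
    simp
  rw [hsub]
  simp

/-- Bordered determinant of a matrix with constant row and column sums, in terms of the
principal submatrix obtained by deleting the first index. -/
theorem det_border_of_sum_eq {m : ℕ} (C : Matrix (Fin (m + 1)) (Fin (m + 1)) R) (s : R)
    (hr : ∀ i, ∑ j, C i j = s) (hc : ∀ j, ∑ i, C i j = s) :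
    (border C).det = -((m : R) + 1) ^ 2 * (C.submatrix Fin.succ Fin.succ).det
      - s * ((m : R) + 1) * (border (C.submatrix Fin.succ Fin.succ)).det := by
  set D := C.submatrix Fin.succ Fin.succ with hD
  set k : R := (m : R) + 1 with hk
  set A := (border C).updateRow 1 (Fin.cons k fun _ => s) with hA
  have hAdet : A.det = (border C).det := by
    have h := det_updateRow_sum (border C) 1 (Fin.cons 0 fun _ => 1)
    rw [show (Fin.cons 0 fun _ => 1 : Fin (m + 2) → R) 1 = 1 from rfl, one_smul] at h
    rw [← h, hA]
    congr 2
    ext j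
    rw [Finset.sum_apply, Fin.sum_univ_succ]
    refine Fin.cases ?_ (fun j => ?_) j <;> simp [hc, hk]
  set F := A.updateCol 1 (Fin.cons k fun _ => 0) with hF
  have hFdet : F.det = A.det := by
    have h := det_updateCol_sum A 1 (Fin.cons (-s) fun _ => 1)
    rw [show (Fin.cons (-s) fun _ => 1 : Fin (m + 2) → R) 1 = 1 from rfl, one_smul] at h
    rw [← h, hF]
    congr 2
    ext i
    rw [Fin.sum_univ_succ]
    refine Fin.cases ?_ (fun i => ?_) i
    · simp [hA, hk]
    · refine Fin.cases ?_ (fun i => ?_) i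
      · simp [hA, hk]
        ring
      · have h1 : i.succ.succ ≠ (1 : Fin (m + 2)) := by
          simp [Fin.ext_iff]
        simp [hA, updateRow_ne h1, hr]
  rw [← hAdet, ← hFdet, det_succ_column F 1, Fin.sum_univ_succ]
  have hsub : F.submatrix (Fin.succAbove 0) (Fin.succAbove 1)
      = (border D).updateRow 0 (Fin.cons k fun _ => s) := by
    have hs : ∀ i : Fin m, i.succ.succ ≠ (1 : Fin (m + 2)) := fun i => by simp [Fin.ext_iff]
    have hone : ∀ j : Fin m, (1 : Fin (m + 2)).succAbove j.succ = j.succ.succ := fun j => by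
      rw [show (1 : Fin (m + 2)) = Fin.succ 0 from rfl, Fin.succ_succAbove_succ]
      simp
    ext i j
    refine Fin.cases ?_ (fun i => ?_) i <;> refine Fin.cases ?_ (fun j => ?_) j <;>
      simp [hF, hA, hone, updateCol_ne (hs _), updateRow_ne (hs _), hD]
  rw [hsub, det_updateRow_zero_border]
  simp [hF]
  ring

end Border

theorem Fin.eq_add_one_iff_val {m : ℕ} (i j : Fin (m + 1)) :
    j = i + 1 ↔ (j : ℕ) = i + 1 ∨ ((i : ℕ) = m ∧ (j : ℕ) = 0) := by
  have hj := j.isLt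
  have hval := Fin.val_add_one i
  by_cases h : i = Fin.last m
  · rw [if_pos h] at hval
    rw [Fin.ext_iff] at h ⊢
    rw [Fin.val_last] at h
    omega
  · rw [if_neg h] at hval
    rw [Fin.ext_iff] at h ⊢
    rw [Fin.val_last] at h
    omega

/-- `-2 (I + A)` for the adjacency matrix `A` of the cycle on `Fin (m + 1)`. -/
def cycleMatrix (m : ℕ) : Matrix (Fin (m + 1)) (Fin (m + 1)) ℝ :=
  Matrix.of fun i j =>
    -2 * ((if j = i then 1 else 0) + (if j = i + 1 then 1 else 0) + (if i = j + 1 then 1 else 0))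

theorem cycleMatrix_row_sum (m : ℕ) (i : Fin (m + 1)) : ∑ j, cycleMatrix m i j = -6 := by
  simp only [cycleMatrix, of_apply, ← Finset.mul_sum, Finset.sum_add_distrib,
    show ∀ j, (i = j + 1) = (j = i - 1) from fun j => by rw [eq_sub_iff_add_eq, @eq_comm _ i]]
  simp
  norm_num

theorem cycleMatrix_col_sum (m : ℕ) (j : Fin (m + 1)) : ∑ i, cycleMatrix m i j = -6 := by
  rw [← cycleMatrix_row_sum m j]
  refine Finset.sum_congr rfl fun i _ => ?_
  simp only [cycleMatrix, of_apply, @eq_comm _ i j]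
  ring

theorem cycleMatrix_submatrix_succ (m : ℕ) :
    (cycleMatrix m).submatrix Fin.succ Fin.succ = tridiag m (-2) (-2) (-2) := by
  ext i j
  have hi := i.isLt
  have hj := j.isLt
  simp only [cycleMatrix, tridiag, submatrix_apply, of_apply, Fin.eq_add_one_iff_val]
  simp only [Fin.ext_iff, Fin.val_succ, Nat.add_eq_zero_iff, one_ne_zero, and_false, or_false]
  split_ifs <;> first | omega | norm_num

theorem natCast_succ_sub_succ_eq_one_iff {m : ℕ} (i j : Fin (m + 1)) :
    (((j.succ : Fin (m + 2)) : ℕ) : ZMod (m + 1)) - ((i.succ : Fin (m + 2)) : ℕ) = 1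
      ↔ j = i + 1 := by
  have hi := i.isLt
  rw [sub_eq_iff_eq_add, Fin.val_succ, Fin.val_succ]
  push_cast
  rw [← add_assoc, add_left_inj, add_comm (1 : ZMod (m + 1)), ← Nat.cast_succ,
    ZMod.natCast_eq_natCast_iff, Nat.ModEq, Nat.mod_eq_of_lt j.isLt, Fin.eq_add_one_iff_val]
  rcases eq_or_ne (i : ℕ) m with h | h
  · rw [h, Nat.mod_self]
    omega
  · rw [Nat.mod_eq_of_lt (by omega)]
    omega

theorem det_EW_eq_det_border (m : ℕ) (hm : 3 ≤ m) :
    (EW (m + 2)).det = (border (cycleMatrix m)).det := by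
  refine det_eq_of_forall_row_eq_smul_add_const (Fin.cons 0 fun _ => 2) 0 (by simp) ?_
  intro i j
  refine Fin.cases ?_ (fun i => ?_) i <;> refine Fin.cases ?_ (fun j => ?_) j
  · simp [EW]
  · simp [EW, (Fin.succ_ne_zero j).symm]
  · simp [EW]
  · have hi := i.isLt
    have hj := j.isLt
    have h1 := natCast_succ_sub_succ_eq_one_iff i j
    have h2 := natCast_succ_sub_succ_eq_one_iff j i
    simp only [EW, of_apply, h1, h2, border_succ_succ, Fin.cons_succ, border_zero_succ,
      cycleMatrix, Fin.eq_add_one_iff_val]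
    simp only [Fin.ext_iff, Fin.val_succ, Nat.add_eq_zero_iff, one_ne_zero, and_false, or_self,
      if_false]
    split_ifs <;> first | omega | norm_num

theorem stmt6 (n : ℕ) (h : 5 ≤ n) :
    (EW n).det =
      -(((n : ℝ) - 1) ^ 2) * (tridiag (n - 2) (-2 : ℝ) (-2) (-2)).det
        + 6 * ((n : ℝ) - 1) * (border (tridiag (n - 2) (-2 : ℝ) (-2) (-2))).det := by
  obtain ⟨m, rfl⟩ := Nat.exists_eq_add_of_le' (show 2 ≤ n by omega)
  rw [det_EW_eq_det_border m (by omega), det_border_of_sum_eq _ (-6) (cycleMatrix_row_sum m)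
    (cycleMatrix_col_sum m), cycleMatrix_submatrix_succ, Nat.add_sub_cancel]
  push_cast
  ring
end
end

section
/- For n ≥ 5, let E(W_n − e) denote the n×n matrix [[0, e'],[e, 2J_{n-1} − T_{n-1}(2,2,2)]], where J is the all-ones matrix and T_{n-1}(2,2,2) is the tridiagonal matrix with all nonzero entries 2. Then det(E(W_n − e)) = 0 if n ≡ 0 (mod 3), det(E(W_n − e)) = 2^{n-2}(n−1)/3 if n ≡ 1 (mod 3), and det(E(W_n − e)) = −2^{n-2}(n+1)/3 if n ≡ 2 (mod 3). -/
open Matrix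

noncomputable section

theorem det_tridiag_add_two {R : Type*} [CommRing R] (m : ℕ) (a b c : R) :
    (tridiag (m + 2) a b c).det =
      a * (tridiag (m + 1) a b c).det - b * c * (tridiag m a b c).det := by
  have h₀ : (tridiag (m + 2) a b c).submatrix Fin.succ Fin.succ = tridiag (m + 1) a b c := by
    ext i j
    simp [tridiag]
  have h₁ : ((tridiag (m + 2) a b c).submatrix Fin.succ (Fin.succAbove 1)).det =
      c * (tridiag m a b c).det := by
    rw [Matrix.det_succ_column_zero, Fin.sum_univ_succ, Finset.sum_eq_zero]
    · have h₂ : ((tridiag (m + 2) a b c).submatrix Fin.succ (Fin.succAbove 1)).submatrix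
          (Fin.succAbove 0) Fin.succ = tridiag m a b c := by
        ext i j
        simp [tridiag]
      rw [h₂]
      simp [tridiag]
    · intro i _
      simp [tridiag]
  rw [Matrix.det_succ_row_zero, Fin.sum_univ_succ, Fin.sum_univ_succ, Finset.sum_eq_zero]
  · simp only [Fin.succAbove_zero, h₀, Fin.succ_zero_eq_one, h₁]
    simp [tridiag]
    ring
  · intro j _
    simp [tridiag]

theorem det_tridiag_neg_two (k : ℕ) :
    (tridiag (3 * k) (-2 : ℝ) (-2) (-2)).det = 8 ^ k ∧
    (tridiag (3 * k + 1) (-2 : ℝ) (-2) (-2)).det = -2 * 8 ^ k ∧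
    (tridiag (3 * k + 2) (-2 : ℝ) (-2) (-2)).det = 0 := by
  induction k with
  | zero =>
    refine ⟨by simp, by simp [tridiag], ?_⟩
    rw [det_tridiag_add_two]
    simp [tridiag]
  | succ k ih =>
    obtain ⟨h₀, h₁, h₂⟩ := ih
    have h₃ : (tridiag (3 * (k + 1)) (-2 : ℝ) (-2) (-2)).det = 8 ^ (k + 1) := by
      rw [show 3 * (k + 1) = 3 * k + 1 + 2 by ring, det_tridiag_add_two, h₂, h₁]
      ring
    have h₄ : (tridiag (3 * (k + 1) + 1) (-2 : ℝ) (-2) (-2)).det = -2 * 8 ^ (k + 1) := by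
      rw [show 3 * (k + 1) + 1 = 3 * k + 2 + 2 by ring, det_tridiag_add_two, h₂,
        show 3 * k + 2 + 1 = 3 * (k + 1) by ring, h₃]
      ring
    refine ⟨h₃, h₄, ?_⟩
    rw [det_tridiag_add_two, h₃, h₄]
    ring

theorem sum_tridiag_mul {R : Type*} [Semiring R] (m : ℕ) (a b c : R) (f : ℕ → R) (i : Fin m) :
    ∑ j : Fin m, tridiag m a b c i j * f j =
      a * f i + (if (i : ℕ) + 1 < m then b * f (i + 1) else 0) +
        (if 0 < (i : ℕ) then c * f (i - 1) else 0) := by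
  obtain ⟨i, hi⟩ := i
  have h : ∀ j : Fin m, tridiag m a b c ⟨i, hi⟩ j * f j =
      (if i = (j : ℕ) then a * f j else 0) + (if i + 1 = (j : ℕ) then b * f j else 0) +
        (if i = (j : ℕ) + 1 then c * f j else 0) := by
    intro j
    simp only [tridiag, Matrix.of_apply]
    split_ifs <;> first | omega | simp
  simp only [h]
  rw [Fin.sum_univ_eq_sum_range (fun j => (if i = j then a * f j else 0) +
    (if i + 1 = j then b * f j else 0) + (if i = j + 1 then c * f j else 0)) m]
  rw [Finset.sum_add_distrib, Finset.sum_add_distrib, Finset.sum_ite_eq, Finset.sum_ite_eq]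
  simp only [Finset.mem_range, hi, if_true]
  congr 1
  cases i with
  | zero => simp
  | succ i =>
    simp only [Nat.add_right_cancel_iff, Finset.sum_ite_eq, Finset.mem_range]
    simp [Nat.lt_of_succ_lt hi]

/-- Subtracting multiples of the border row removes a constant from the inner block. -/
theorem det_border_const_add {R : Type*} [CommRing R] {m : ℕ} (t : R)
    (A : Matrix (Fin m) (Fin m) R) :
    (border (Matrix.of (fun _ _ => t) + A)).det = (border A).det := by
  refine Matrix.det_eq_of_forall_row_eq_smul_add_const
    (fun i => if i = 0 then 0 else t) 0 (by simp) ?_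
  intro i j
  refine Fin.cases ?_ (fun i => ?_) i <;> refine Fin.cases ?_ (fun j => ?_) j <;>
    simp [border, add_comm]

theorem mul_det_border {R : Type*} [CommRing R] {m : ℕ} (A : Matrix (Fin m) (Fin m) R)
    (t : R) (x : Fin m → R) (hx : ∀ i, ∑ j, A i j * x j = -t) :
    t * (border A).det = (∑ j, x j) * A.det := by
  have h := Matrix.det_updateCol_sum (border A) 0 (Fin.cons t x)
  rw [Fin.cons_zero, smul_eq_mul] at h
  rw [← h, Matrix.det_succ_column_zero, Fin.sum_univ_succ, Finset.sum_eq_zero]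
  · have hs : ((border A).updateCol 0 fun k => ∑ i, (Fin.cons t x : Fin (m + 1) → R) i •
        border A k i).submatrix (Fin.succAbove 0) Fin.succ = A := by
      ext i j
      simp [border]
    rw [hs]
    simp [border, Fin.sum_univ_succ]
  · intro i _
    have hi := hx i
    simp only [mul_comm (A i _)] at hi
    simp [border, Fin.sum_univ_succ, hi]

theorem two_mul_det_border (m r : ℕ) (hr : r = if m % 3 = 1 then 0 else 1) :
    2 * (border ((Matrix.of fun _ _ => (2 : ℝ)) - tridiag m (2 : ℝ) 2 2)).det =
      (∑ j ∈ Finset.range m, if j % 3 = r then (1 : ℝ) else 0) *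
        (tridiag m (-2 : ℝ) (-2) (-2)).det := by
  have hA : (Matrix.of fun _ _ => (2 : ℝ)) - tridiag m (2 : ℝ) 2 2 =
      (Matrix.of fun _ _ => (2 : ℝ)) + tridiag m (-2 : ℝ) (-2) (-2) := by
    ext i j
    simp only [tridiag, Matrix.sub_apply, Matrix.add_apply, Matrix.of_apply]
    split_ifs <;> ring
  rw [hA, det_border_const_add, ← Fin.sum_univ_eq_sum_range]
  apply mul_det_border
  intro i
  rw [sum_tridiag_mul m (-2 : ℝ) (-2) (-2) (fun j => if j % 3 = r then 1 else 0) i]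
  have := i.isLt
  subst hr
  split_ifs <;> first | omega | norm_num

theorem sum_range_mod_three (k : ℕ) :
    (∑ j ∈ Finset.range (3 * k), if j % 3 = 1 then (1 : ℝ) else 0) = k ∧
    (∑ j ∈ Finset.range (3 * k + 1), if j % 3 = 0 then (1 : ℝ) else 0) = k + 1 := by
  induction k with
  | zero => constructor <;> norm_num [Finset.sum_range_succ, -Finset.sum_boole]
  | succ k ih =>
    obtain ⟨h₀, h₁⟩ := ih
    constructor
    · rw [show 3 * (k + 1) = 3 * k + 1 + 1 + 1 by ring, Finset.sum_range_succ,
        Finset.sum_range_succ, Finset.sum_range_succ, h₀]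
      norm_num [Nat.add_mod, Nat.mul_mod]
    · rw [show 3 * (k + 1) + 1 = 3 * k + 1 + 1 + 1 + 1 by ring, Finset.sum_range_succ,
        Finset.sum_range_succ, Finset.sum_range_succ, h₁]
      norm_num [Nat.add_mod, Nat.mul_mod]

theorem stmt12 (n : ℕ) (h : 5 ≤ n) :
    (border ((Matrix.of fun _ _ => (2 : ℝ)) - tridiag (n - 1) (2 : ℝ) 2 2)).det =
      if n % 3 = 0 then 0
      else if n % 3 = 1 then 2 ^ (n - 2) * ((n : ℝ) - 1) / 3
      else -(2 ^ (n - 2) * ((n : ℝ) + 1) / 3) := by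
  have key := two_mul_det_border (n - 1) _ rfl
  obtain ⟨k, hk | hk | hk⟩ : ∃ k, n = 3 * k + 1 ∨ n = 3 * k + 2 ∨ n = 3 * k + 3 :=
    ⟨(n - 1) / 3, by omega⟩
  · have hp : (8 : ℝ) ^ k = 2 * 2 ^ (n - 2) := by
      rw [← pow_succ', show n - 2 + 1 = 3 * k by omega, pow_mul]
      norm_num
    have hm : n - 1 = 3 * k := by omega
    rw [if_neg (by omega), if_pos (by omega)]
    rw [if_neg (by omega)] at key
    have hn : (n : ℝ) = 3 * k + 1 := by exact_mod_cast hk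
    have hr : (∑ j ∈ Finset.range (n - 1), if j % 3 = 1 then (1 : ℝ) else 0) *
        (tridiag (n - 1) (-2 : ℝ) (-2) (-2)).det = k * 8 ^ k := by
      rw [hm, (sum_range_mod_three k).1, (det_tridiag_neg_two k).1]
    rw [hr, hp] at key
    rw [hn]
    linear_combination key / 2
  · have hp : (8 : ℝ) ^ k = 2 ^ (n - 2) := by
      rw [show n - 2 = 3 * k by omega, pow_mul]
      norm_num
    have hm : n - 1 = 3 * k + 1 := by omega
    rw [if_neg (by omega), if_neg (by omega)]
    rw [if_pos (by omega)] at key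
    have hn : (n : ℝ) = 3 * k + 2 := by exact_mod_cast hk
    have hr : (∑ j ∈ Finset.range (n - 1), if j % 3 = 0 then (1 : ℝ) else 0) *
        (tridiag (n - 1) (-2 : ℝ) (-2) (-2)).det = (k + 1) * (-2 * 8 ^ k) := by
      rw [hm, (sum_range_mod_three k).2, (det_tridiag_neg_two k).2.1]
    rw [hr, hp] at key
    rw [hn]
    linear_combination key / 2
  · have hm : n - 1 = 3 * k + 2 := by omega
    have hd : (tridiag (n - 1) (-2 : ℝ) (-2) (-2)).det = 0 := by
      rw [hm, (det_tridiag_neg_two k).2.2]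
    rw [if_pos (by omega)]
    rw [hd, mul_zero] at key
    linarith
end
end

section
/- For n ≥ 5 with n ≡ 1 (mod 3), the vectors x = (0, 1,0,−1, …, 1,0,−1)' and y = (0, 0,1,−1, …, 0,1,−1)' in R^n satisfy E(W_n)x = 0 and E(W_n)y = 0 and are linearly independent. -/
open Matrix

noncomputable section

/-- The vector `(0, 1,0,-1, 1,0,-1, …)` in `R^n`. -/
def xvec (n : ℕ) : Fin n → ℝ := fun i =>
  if (i : ℕ) = 0 then 0
  else if (i : ℕ) % 3 = 1 then 1
  else if (i : ℕ) % 3 = 2 then 0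
  else -1

/-- The vector `(0, 0,1,-1, 0,1,-1, …)` in `R^n`. -/
def yvec (n : ℕ) : Fin n → ℝ := fun i =>
  if (i : ℕ) = 0 then 0
  else if (i : ℕ) % 3 = 1 then 0
  else if (i : ℕ) % 3 = 2 then 1
  else -1

theorem zmod_natCast_sub_eq_one_iff {m i j : ℕ} (hi : 1 ≤ i) (him : i ≤ m)
    (hj : 1 ≤ j) (hjm : j ≤ m) :
    ((j : ZMod m) - (i : ZMod m) = 1) ↔ (j = i + 1 ∨ (i = m ∧ j = 1)) := by
  have h : ((j : ZMod m) - (i : ZMod m) = 1) ↔ ((m : ℤ) ∣ ((i : ℤ) + 1) - j) := by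
    rw [sub_eq_iff_eq_add', ← Nat.cast_one, ← Nat.cast_add, ZMod.natCast_eq_natCast_iff,
      Nat.modEq_iff_dvd]
    push_cast
    rfl
  rw [h]
  constructor
  · rintro ⟨c, hc⟩
    have hlo : -1 < c := by
      by_contra! hcon
      nlinarith
    have hup : c < 2 := by
      by_contra! hcon
      nlinarith
    interval_cases c <;> omega
  · rintro (rfl | ⟨rfl, rfl⟩) <;> simp

theorem sum_range_periodic_eq_zero {f : ℕ → ℝ} (hf0 : f 0 = 0)
    (hf : ∀ a, f (a + 1) + f (a + 2) + f (a + 3) = 0) (k : ℕ) :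
    ∑ j ∈ Finset.range (3 * k + 1), f j = 0 := by
  induction k with
  | zero => simpa using hf0
  | succ k ih =>
    rw [show 3 * (k + 1) + 1 = 3 * k + 1 + 1 + 1 + 1 by ring, Finset.sum_range_succ,
      Finset.sum_range_succ, Finset.sum_range_succ, ih]
    linarith [hf (3 * k)]

/-- A vector vanishing at the hub whose consecutive triples along the cycle sum to zero
lies in the kernel of the eccentricity matrix of the wheel. -/
theorem EW_mulVec_eq_zero {n : ℕ} (h : 5 ≤ n) (h1 : n % 3 = 1) {f : ℕ → ℝ} (hf0 : f 0 = 0)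
    (hf : ∀ a, f (a + 1) + f (a + 2) + f (a + 3) = 0) :
    (EW n).mulVec (fun i => f i) = 0 := by
  obtain ⟨k, rfl⟩ : ∃ k, n = 3 * k + 1 := ⟨n / 3, by omega⟩
  have hsum : ∑ j : Fin (3 * k + 1), f j = 0 := by
    rw [Fin.sum_univ_eq_sum_range f]
    exact sum_range_periodic_eq_zero hf0 hf k
  have hper : ∀ a b, f (a + 1 + 3 * b) = f (a + 1) := by
    intro a b
    induction b with
    | zero => simp
    | succ b ih =>
      rw [← ih, show a + 1 + 3 * (b + 1) = a + 3 * b + 1 + 3 by ring,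
        show a + 1 + 3 * b = a + 3 * b + 1 by ring]
      linarith [hf (a + 3 * b), hf (a + 3 * b + 1)]
  ext i
  simp only [Matrix.mulVec, dotProduct, Pi.zero_apply]
  by_cases hi : (i : ℕ) = 0
  · rw [← hsum]
    refine Finset.sum_congr rfl fun j _ => ?_
    by_cases hj : i = j
    · subst hj
      simp [hi, hf0]
    · simp only [EW, Matrix.of_apply, hi, hj, if_false, true_or, if_true, one_mul]
  obtain ⟨i, hin⟩ := i
  simp only at hi
  obtain ⟨s, hs⟩ : ∃ s : Fin (3 * k + 1), (s : ℕ) = if i = 3 * k then 1 else i + 1 :=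
    ⟨⟨if i = 3 * k then 1 else i + 1, by split_ifs <;> omega⟩, rfl⟩
  obtain ⟨p, hp⟩ : ∃ p : Fin (3 * k + 1), (p : ℕ) = if i = 1 then 3 * k else i - 1 :=
    ⟨⟨if i = 1 then 3 * k else i - 1, by split_ifs <;> omega⟩, rfl⟩
  have hterm : ∀ j : Fin (3 * k + 1), EW (3 * k + 1) ⟨i, hin⟩ j * f j =
      2 * f j - 2 * (if j = ⟨i, hin⟩ then f j else 0) - 2 * (if j = s then f j else 0)
        - 2 * (if j = p then f j else 0) := by
    rintro ⟨j, hjn⟩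
    by_cases hj : j = 0
    · subst hj
      simp [hf0]
    have hnext := zmod_natCast_sub_eq_one_iff (m := 3 * k) (i := i) (j := j)
      (by omega) (by omega) (by omega) (by omega)
    have hprev := zmod_natCast_sub_eq_one_iff (m := 3 * k) (i := j) (j := i)
      (by omega) (by omega) (by omega) (by omega)
    simp only [EW, Matrix.of_apply, hnext, hprev, Fin.ext_iff, hs, hp,
      hi, hj, or_self, if_false]
    split_ifs <;> first | omega | ring
  have htriple : f i + f s + f p = 0 := by
    rw [hs, hp]
    split_ifs with ha hb hb
    · omega
    · obtain ⟨c, rfl⟩ : ∃ c, k = c + 1 := ⟨k - 1, by omega⟩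
      have e1 := hper 0 (c + 1)
      have e2 := hf (3 * c + 1)
      rw [show 3 * c + 1 + 3 = 0 + 1 + 3 * (c + 1) by ring] at e2
      rw [ha, show 3 * (c + 1) - 1 = 3 * c + 1 + 1 by omega,
        show 3 * (c + 1) = 3 * c + 1 + 2 by ring]
      simp only [zero_add] at e1 e2
      linarith
    · obtain ⟨c, rfl⟩ : ∃ c, k = c + 1 := ⟨k - 1, by omega⟩
      have e1 := hper 2 c
      have e2 := hf 0
      rw [show 2 + 1 + 3 * c = 3 * (c + 1) by ring] at e1
      rw [hb, e1]
      simp only [zero_add] at e2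
      norm_num
      linarith
    · obtain ⟨a, rfl⟩ : ∃ a, i = a + 2 := ⟨i - 2, by omega⟩
      have e := hf a
      rw [show a + 2 - 1 = a + 1 by omega, show a + 2 + 1 = a + 3 by ring]
      linarith
  simp only [hterm, Finset.sum_sub_distrib, ← Finset.mul_sum, Finset.sum_ite_eq',
    Finset.mem_univ, if_true, hsum]
  linarith

theorem stmt14 (n : ℕ) (h : 5 ≤ n) (h1 : n % 3 = 1) :
    (EW n).mulVec (xvec n) = 0 ∧ (EW n).mulVec (yvec n) = 0 ∧
      LinearIndependent ℝ ![xvec n, yvec n] := by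
  refine ⟨?_, ?_, ?_⟩
  · refine EW_mulVec_eq_zero h h1 (f := fun i =>
      if i = 0 then 0 else if i % 3 = 1 then 1 else if i % 3 = 2 then 0 else -1) rfl fun a => ?_
    split_ifs <;> first | omega | norm_num
  · refine EW_mulVec_eq_zero h h1 (f := fun i =>
      if i = 0 then 0 else if i % 3 = 1 then 0 else if i % 3 = 2 then 1 else -1) rfl fun a => ?_
    split_ifs <;> first | omega | norm_num
  · rw [LinearIndependent.pair_iff]
    intro s t hst
    have hs := congrFun hst ⟨1, by omega⟩
    have ht := congrFun hst ⟨2, by omega⟩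
    simp [xvec, yvec] at hs ht
    exact ⟨hs, ht⟩
end
end

section
/- For n ≥ 5, the inertia (i_+, i_−, i_0) of the eccentricity matrix E(W_n) is ((n+3)/3, (2n−3)/3, 0) if n ≡ 0 (mod 3); ((n−1)/3, (2n−5)/3, 2) if n ≡ 1 (mod 3); and ((n+1)/3, (2n−1)/3, 0) if n ≡ 2 (mod 3). -/
open Matrix

noncomputable section

theorem eigenvalues_map_eq_of_mul_eq_mul_diagonal {ι κ : Type*} [Fintype ι] [DecidableEq ι]
    [Fintype κ] [DecidableEq κ] {A : Matrix ι ι ℝ} (hA : A.IsHermitian) (e : ι ≃ κ)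
    (P : Matrix κ κ ℂ) (d : κ → ℝ) (hdet : P.det ≠ 0)
    (hP : Matrix.reindex e e (A.map Complex.ofRealHom) * P =
      P * Matrix.diagonal fun k => (d k : ℂ)) :
    Finset.univ.val.map hA.eigenvalues = Finset.univ.val.map d := by
  have hu : IsUnit P.det := isUnit_iff_ne_zero.2 hdet
  have h1 : Matrix.reindex e e (A.map Complex.ofRealHom) =
      P * Matrix.diagonal (fun k => (d k : ℂ)) * P⁻¹ := by
    rw [← hP, Matrix.mul_nonsing_inv_cancel_right _ _ hu]
  have h2 : (A.charpoly).map Complex.ofRealHom =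
      (Matrix.diagonal (fun k => (d k : ℂ))).charpoly := by
    rw [← Matrix.charpoly_map, ← Matrix.charpoly_reindex e, h1, mul_assoc,
      Matrix.charpoly_mul_comm, mul_assoc, Matrix.nonsing_inv_mul _ hu, mul_one]
  have h3 : A.charpoly = ∏ k, (Polynomial.X - Polynomial.C (d k)) := by
    apply Polynomial.map_injective _ Complex.ofRealHom.injective
    rw [h2, Matrix.charpoly_diagonal, Polynomial.map_prod]
    simp
  have h4 := hA.roots_charpoly_eq_eigenvalues
  have h5 : ∏ k, (Polynomial.X - Polynomial.C (d k)) =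
      ((Finset.univ.val.map d).map fun x => Polynomial.X - Polynomial.C x).prod := by
    rw [Multiset.map_map]
    rfl
  rw [h3, h5, Polynomial.roots_multiset_prod_X_sub_C] at h4
  simpa using h4.symm

theorem card_filter_comp_eq_of_map_eq {ι κ α : Type*} [Fintype ι] [Fintype κ]
    {f : ι → α} {g : κ → α}
    (h : Finset.univ.val.map f = Finset.univ.val.map g) (p : α → Prop) [DecidablePred p] :
    (Finset.univ.filter fun i => p (f i)).card = (Finset.univ.filter fun k => p (g k)).card := by
  have := congrArg (Multiset.countP p) h
  rw [Multiset.countP_map, Multiset.countP_map] at this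
  exact this

theorem sin_mul_one_add_two_mul_cos (x : ℝ) :
    Real.sin x * (1 + 2 * Real.cos (2 * x)) = Real.sin (3 * x) := by
  rw [Real.sin_three_mul, Real.cos_two_mul, Real.cos_sq']
  ring

/-- The eigenvalue of the Fourier mode `j` of the cyclic part of the wheel. -/
def cycleEigenvalue (m j : ℕ) : ℝ := -2 * (1 + 2 * Real.cos (2 * (Real.pi * j / m)))

theorem sin_pi_mul_div_pos {m j : ℕ} (h0 : 0 < j) (hj : j < m) :
    0 < Real.sin (Real.pi * j / m) := by
  have hm : (0 : ℝ) < m := by exact_mod_cast h0.trans hj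
  have hj' : (j : ℝ) < m := by exact_mod_cast hj
  have h0' : (0 : ℝ) < j := by exact_mod_cast h0
  apply Real.sin_pos_of_pos_of_lt_pi
  · positivity
  · rw [div_lt_iff₀ hm]
    exact mul_lt_mul_of_pos_left hj' Real.pi_pos

theorem sin_mul_cycleEigenvalue (m j : ℕ) :
    Real.sin (Real.pi * j / m) * cycleEigenvalue m j = -2 * Real.sin (3 * (Real.pi * j / m)) := by
  rw [← sin_mul_one_add_two_mul_cos, cycleEigenvalue]
  ring

theorem cycleEigenvalue_neg {m j : ℕ} (h0 : 0 < j) (hj : j < m)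
    (h : 3 * j < m ∨ 2 * m < 3 * j) : cycleEigenvalue m j < 0 := by
  have hs := sin_pi_mul_div_pos h0 hj
  have hm : (0 : ℝ) < m := by exact_mod_cast h0.trans hj
  have h0' : (0 : ℝ) < j := by exact_mod_cast h0
  have hj' : (j : ℝ) < m := by exact_mod_cast hj
  suffices 0 < Real.sin (3 * (Real.pi * j / m)) by
    have := sin_mul_cycleEigenvalue m j
    by_contra! hc
    nlinarith [mul_nonneg hs.le hc]
  have hx : 3 * (Real.pi * j / m) = Real.pi * (3 * j / m) := by ring
  rcases h with h | h
  · have h' : (3 * j : ℝ) < m := by exact_mod_cast h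
    apply Real.sin_pos_of_pos_of_lt_pi
    · positivity
    · rw [hx]
      exact mul_lt_of_lt_one_right Real.pi_pos (by rwa [div_lt_one hm])
  · have h' : (2 * m : ℝ) < 3 * j := by exact_mod_cast h
    have h2 : (2 : ℝ) < 3 * j / m := by rwa [lt_div_iff₀ hm]
    have h3 : (3 * j / m : ℝ) < 3 := by rw [div_lt_iff₀ hm]; linarith
    rw [← Real.sin_sub_two_pi, hx]
    apply Real.sin_pos_of_pos_of_lt_pi <;> nlinarith [Real.pi_pos]

theorem cycleEigenvalue_pos {m j : ℕ} (h1 : m < 3 * j) (h2 : 3 * j < 2 * m) :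
    0 < cycleEigenvalue m j := by
  have hs := sin_pi_mul_div_pos (m := m) (j := j) (by omega) (by omega)
  have hm : (0 : ℝ) < m := by exact_mod_cast (by omega : 0 < m)
  suffices Real.sin (3 * (Real.pi * j / m)) < 0 by
    have := sin_mul_cycleEigenvalue m j
    by_contra! hc
    nlinarith [mul_nonneg hs.le (neg_nonneg.2 hc)]
  have hx : 3 * (Real.pi * j / m) = Real.pi * (3 * j / m) := by ring
  have h1' : (m : ℝ) < 3 * j := by exact_mod_cast h1
  have h2' : (3 * j : ℝ) < 2 * m := by exact_mod_cast h2
  have h3 : (1 : ℝ) < 3 * j / m := by rwa [one_lt_div hm]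
  have h4 : (3 * j / m : ℝ) < 2 := by rwa [div_lt_iff₀ hm]
  rw [← Real.sin_sub_two_pi, hx]
  apply Real.sin_neg_of_neg_of_neg_pi_lt <;> nlinarith [Real.pi_pos]

theorem cycleEigenvalue_eq_zero {m j : ℕ} (h0 : 0 < j) (hj : j < m)
    (h : 3 * j = m ∨ 3 * j = 2 * m) : cycleEigenvalue m j = 0 := by
  have hs := sin_pi_mul_div_pos h0 hj
  have hm : (m : ℝ) ≠ 0 := by exact_mod_cast (by omega : m ≠ 0)
  have hx : 3 * (Real.pi * j / m) = Real.pi * (3 * j / m) := by ring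
  have hsin : Real.sin (3 * (Real.pi * j / m)) = 0 := by
    rcases h with h | h
    · have h' : (3 * j : ℝ) = m := by exact_mod_cast h
      rw [hx, h', div_self hm, mul_one, Real.sin_pi]
    · have h' : (3 * j : ℝ) = 2 * m := by exact_mod_cast h
      rw [hx, h', mul_div_cancel_right₀ _ hm, mul_comm, Real.sin_two_pi]
  have := sin_mul_cycleEigenvalue m j
  rw [hsin, mul_zero] at this
  exact (mul_eq_zero.1 this).resolve_left hs.ne'

/-- The eccentricity matrix of the wheel with `m` spokes, indexed by the hub `none` and the
cycle `ZMod m`. -/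
def wheelMatrix (m : ℕ) : Matrix (Option (ZMod m)) (Option (ZMod m)) ℝ
  | none, none => 0
  | none, some _ => 1
  | some _, none => 1
  | some a, some b => if a = b then 0 else if b - a = 1 ∨ a - b = 1 then 0 else 2

/-- The label in `Option (ZMod m)` of a vertex of the wheel. -/
def wheelLabel (m : ℕ) : Fin (m + 1) → Option (ZMod m) :=
  Fin.cases none fun i => some ((i.val + 1 : ℕ) : ZMod m)

theorem wheelLabel_injective (m : ℕ) : Function.Injective (wheelLabel m) := by
  intro i j
  cases i using Fin.cases <;> cases j using Fin.cases <;> simp [wheelLabel]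
  rename_i i j
  intro h
  rw [ZMod.natCast_eq_natCast_iff', Nat.mod_eq_of_lt i.2, Nat.mod_eq_of_lt j.2] at h
  exact Fin.ext h

/-- The labelling of the vertices of the wheel as an equivalence. -/
def wheelEquiv (m : ℕ) [NeZero m] : Fin (m + 1) ≃ Option (ZMod m) :=
  Equiv.ofBijective (wheelLabel m)
    ((Fintype.bijective_iff_injective_and_card _).2 ⟨wheelLabel_injective m, by simp⟩)

theorem reindex_EW (m : ℕ) [NeZero m] :
    Matrix.reindex (wheelEquiv m) (wheelEquiv m) (EW (m + 1)) = wheelMatrix m := by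
  rw [← Equiv.eq_symm_apply]
  ext i j
  have hinj := (wheelLabel_injective m).eq_iff (a := i) (b := j)
  change EW (m + 1) i j = wheelMatrix m (wheelLabel m i) (wheelLabel m j)
  cases i using Fin.cases <;> cases j using Fin.cases
  · simp [EW, wheelLabel, wheelMatrix]
  · simp [EW, wheelLabel, wheelMatrix, (Fin.succ_ne_zero _).symm]
  · simp [EW, wheelLabel, wheelMatrix]
  · simp only [wheelLabel, Fin.cases_succ, Option.some_inj] at hinj
    simp only [wheelLabel, wheelMatrix, EW, Fin.cases_succ, Matrix.of_apply, hinj]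
    simp

theorem wheelMatrix_some_some {m : ℕ} (hm : 4 ≤ m) (a b : ZMod m) :
    wheelMatrix m (some a) (some b) =
      2 - 2 * (if b = a then 1 else 0) - 2 * (if b = a + 1 then 1 else 0)
        - 2 * (if b = a + -1 then 1 else 0) := by
  have h1 : (1 : ZMod m) ≠ 0 := by
    have : Fact (1 < m) := ⟨by omega⟩
    exact one_ne_zero
  have h2 : (1 : ZMod m) ≠ -1 := by
    intro h
    have h' : ((2 : ℕ) : ZMod m) = 0 := by push_cast; linear_combination h
    rw [ZMod.natCast_eq_zero_iff] at h'
    exact absurd (Nat.le_of_dvd two_pos h') (by omega)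
  obtain ⟨c, rfl⟩ : ∃ c, b = a + c := ⟨b - a, by ring⟩
  have h3 : a - (a + c) = 1 ↔ c = -1 := by
    constructor <;> intro h <;> linear_combination -h
  simp only [wheelMatrix, add_sub_cancel_left, h3, left_eq_add, add_eq_left, add_right_inj]
  by_cases hc0 : c = 0
  · subst hc0
    simp [h1, h1.symm]
  by_cases hc1 : c = 1
  · subst hc1
    simp [h1, h2]
  by_cases hc2 : c = -1
  · subst hc2
    simp [h1, h2.symm]
  simp [hc0, hc1, hc2]

theorem wheelMatrix_sum {m : ℕ} [NeZero m] (hm : 4 ≤ m) (a : ZMod m) (v : ZMod m → ℂ) :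
    ∑ b, (wheelMatrix m (some a) (some b) : ℂ) * v b =
      2 * ∑ b, v b - 2 * v a - 2 * v (a + 1) - 2 * v (a + -1) := by
  have h : ∀ b, (wheelMatrix m (some a) (some b) : ℂ) * v b =
      2 * v b - 2 * (if b = a then v b else 0) - 2 * (if b = a + 1 then v b else 0)
        - 2 * (if b = a + -1 then v b else 0) := by
    intro b
    rw [wheelMatrix_some_some hm]
    push_cast
    split_ifs <;> push_cast <;> ring
  simp_rw [h, Finset.sum_sub_distrib, ← Finset.mul_sum]
  simp

/-- One of the two roots of `x ^ 2 = 2 * (m - 3) * x + m`, according to the sign `s = ±1`. -/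
def hubEigenvalue (m : ℕ) (s : ℝ) : ℝ := (m - 3) + s * √((m - 3) ^ 2 + m)

theorem hubEigenvalue_sq (m : ℕ) {s : ℝ} (hs : s ^ 2 = 1) :
    hubEigenvalue m s ^ 2 = 2 * (m - 3) * hubEigenvalue m s + m := by
  have h := Real.sq_sqrt (show (0 : ℝ) ≤ (m - 3) ^ 2 + m by positivity)
  unfold hubEigenvalue
  linear_combination s ^ 2 * h + ((m - 3 : ℝ) ^ 2 + m) * hs

theorem abs_sub_three_lt_sqrt {m : ℕ} (hm : 0 < m) : |(m : ℝ) - 3| < √((m - 3) ^ 2 + m) := by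
  have : (0 : ℝ) < m := by exact_mod_cast hm
  exact Real.lt_sqrt_of_sq_lt (by rw [sq_abs]; linarith)

theorem hubEigenvalue_pos {m : ℕ} (hm : 0 < m) : 0 < hubEigenvalue m 1 := by
  have := abs_lt.1 (abs_sub_three_lt_sqrt hm)
  unfold hubEigenvalue
  linarith

theorem hubEigenvalue_neg {m : ℕ} (hm : 0 < m) : hubEigenvalue m (-1) < 0 := by
  have := abs_lt.1 (abs_sub_three_lt_sqrt hm)
  unfold hubEigenvalue
  linarith

theorem hubEigenvalue_mul (m : ℕ) : hubEigenvalue m 1 * hubEigenvalue m (-1) = -m := by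
  have h := Real.sq_sqrt (show (0 : ℝ) ≤ (m - 3) ^ 2 + m by positivity)
  unfold hubEigenvalue
  linear_combination -h

/-- The eigenvalues of `wheelMatrix m` other than `hubEigenvalue m (-1)`. -/
def wheelEigenvalueSome (m j : ℕ) : ℝ := if j = 0 then hubEigenvalue m 1 else cycleEigenvalue m j

/-- The spectrum of `wheelMatrix m`. -/
def wheelEigenvalue (m : ℕ) : Option (ZMod m) → ℝ
  | none => hubEigenvalue m (-1)
  | some b => wheelEigenvalueSome m b.val

/-- The matrix whose columns are eigenvectors of `wheelMatrix m`. -/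
def wheelEigenvectors (m : ℕ) [NeZero m] : Matrix (Option (ZMod m)) (Option (ZMod m)) ℂ
  | none, none => m
  | none, some b => if b = 0 then m else 0
  | some _, none => hubEigenvalue m (-1)
  | some a, some b => if b = 0 then (hubEigenvalue m 1 : ℂ) else ZMod.stdAddChar (a * b)

theorem sum_stdAddChar_mul {m : ℕ} [NeZero m] (b : ZMod m) :
    ∑ a, ZMod.stdAddChar (a * b) = if b = 0 then (m : ℂ) else 0 := by
  rw [AddChar.sum_mulShift b (ZMod.isPrimitive_stdAddChar m), ZMod.card]
  split_ifs <;> simp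

theorem cycleEigenvalue_val {m : ℕ} [NeZero m] (b : ZMod m) :
    (cycleEigenvalue m b.val : ℂ) =
      -2 * (1 + ZMod.stdAddChar b + ZMod.stdAddChar (-b)) := by
  have h1 : ZMod.stdAddChar b = Complex.exp ((2 * (Real.pi * b.val / m) : ℝ) * Complex.I) := by
    have := ZMod.stdAddChar_coe (N := m) (b.val : ℤ)
    rw [Int.cast_natCast, ZMod.natCast_zmod_val] at this
    rw [this]
    push_cast
    ring_nf
  have h2 : ZMod.stdAddChar (-b) =
      Complex.exp (-(2 * (Real.pi * b.val / m) : ℝ) * Complex.I) := by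
    rw [AddChar.map_neg_eq_inv, h1, ← Complex.exp_neg, neg_mul]
  rw [h1, h2, cycleEigenvalue]
  push_cast
  rw [Complex.cos]
  ring

theorem wheelMatrix_mul_wheelEigenvectors {m : ℕ} [NeZero m] (hm : 4 ≤ m) :
    (wheelMatrix m).map Complex.ofRealHom * wheelEigenvectors m =
      wheelEigenvectors m * Matrix.diagonal fun k => (wheelEigenvalue m k : ℂ) := by
  have hs : ∀ s : ℝ, s ^ 2 = 1 → (hubEigenvalue m s : ℂ) ^ 2 =
      2 * (m - 3) * hubEigenvalue m s + m := by
    intro s hs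
    exact_mod_cast congrArg (fun x : ℝ => (x : ℂ)) (hubEigenvalue_sq m hs)
  have h1 := hs 1 (by norm_num)
  have h2 := hs (-1) (by norm_num)
  ext i k
  rw [Matrix.mul_diagonal, Matrix.mul_apply, Fintype.sum_option]
  simp only [Matrix.map_apply, Complex.ofRealHom_eq_coe]
  rcases i with _ | a <;> rcases k with _ | b
  · simp [wheelMatrix, wheelEigenvectors, wheelEigenvalue]
  · by_cases hb : b = 0
    · subst hb
      simp [wheelMatrix, wheelEigenvectors, wheelEigenvalue, wheelEigenvalueSome]
    · simp [wheelMatrix, wheelEigenvectors, hb, sum_stdAddChar_mul]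
  · rw [wheelMatrix_sum hm a fun b => wheelEigenvectors m (some b) none]
    simp [wheelMatrix, wheelEigenvectors, wheelEigenvalue]
    linear_combination -h2
  · rw [wheelMatrix_sum hm a fun c => wheelEigenvectors m (some c) (some b)]
    by_cases hb : b = 0
    · subst hb
      simp [wheelMatrix, wheelEigenvectors, wheelEigenvalue, wheelEigenvalueSome]
      linear_combination -h1
    · simp [wheelMatrix, wheelEigenvectors, wheelEigenvalue, wheelEigenvalueSome, hb,
        sum_stdAddChar_mul, cycleEigenvalue_val, add_mul, AddChar.map_add_eq_mul]
      ring

theorem wheelEigenvectors_det_ne_zero {m : ℕ} [NeZero m] : (wheelEigenvectors m).det ≠ 0 := by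
  have hm : 0 < m := Nat.pos_of_neZero m
  have hmR : (0 : ℝ) < m := by exact_mod_cast hm
  have hmC : (m : ℂ) ≠ 0 := by exact_mod_cast hm.ne'
  have hmul : (hubEigenvalue m 1 : ℂ) * hubEigenvalue m (-1) = -m := by
    exact_mod_cast congrArg (fun x : ℝ => (x : ℂ)) (hubEigenvalue_mul m)
  let c : Option (ZMod m) → ℂ
    | none => m ^ 2 + m * hubEigenvalue m (-1) ^ 2
    | some b => if b = 0 then m ^ 2 + m * hubEigenvalue m 1 ^ 2 else (m : ℂ)
  have hpos : ∀ x : ℝ, (m : ℂ) ^ 2 + m * x ^ 2 ≠ 0 := by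
    intro x
    have : (m : ℝ) ^ 2 + m * x ^ 2 ≠ 0 := by positivity
    exact_mod_cast this
  have hc : ∀ k, c k ≠ 0 := by
    rintro (_ | b)
    · exact hpos _
    · simp only [c]
      split_ifs
      · exact hpos _
      · exact hmC
  have hconj : ∀ x : ZMod m, (starRingEnd ℂ) (ZMod.stdAddChar x) = ZMod.stdAddChar (-x) :=
    fun x => (AddChar.map_neg_eq_conj _ x).symm
  have hsum : ∀ b : ZMod m, ∑ a, ZMod.stdAddChar (-(a * b)) = if b = 0 then (m : ℂ) else 0 := by
    intro b
    simpa using sum_stdAddChar_mul (-b)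
  have key : (wheelEigenvectors m)ᴴ * wheelEigenvectors m = Matrix.diagonal c := by
    ext i k
    rw [Matrix.mul_apply, Fintype.sum_option]
    simp only [Matrix.conjTranspose_apply]
    rcases i with _ | a <;> rcases k with _ | b
    · simp [wheelEigenvectors, c]
      ring
    · by_cases hb : b = 0
      · subst hb
        simp [wheelEigenvectors]
        linear_combination (m : ℂ) * hmul
      · simp [wheelEigenvectors, hb, ← Finset.mul_sum, sum_stdAddChar_mul]
    · by_cases ha : a = 0
      · subst ha
        simp [wheelEigenvectors]
        linear_combination (m : ℂ) * hmul
      · simp [wheelEigenvectors, ha, ← Finset.sum_mul, hconj, hsum]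
    · by_cases ha : a = 0 <;> by_cases hb : b = 0
      · subst ha hb
        simp [wheelEigenvectors, c]
        ring
      · subst ha
        simp [wheelEigenvectors, hb, Ne.symm hb, ← Finset.mul_sum, sum_stdAddChar_mul]
      · subst hb
        simp [wheelEigenvectors, ha, ← Finset.sum_mul, hconj, hsum]
      · have h : ∀ x : ZMod m, ZMod.stdAddChar (-(x * a)) * ZMod.stdAddChar (x * b) =
            ZMod.stdAddChar (x * (b - a)) := by
          intro x
          rw [← AddChar.map_add_eq_mul]
          congr 1
          ring
        simp [wheelEigenvectors, ha, hb, hconj, h, sum_stdAddChar_mul, c, Matrix.diagonal_apply,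
          sub_eq_zero, eq_comm]
  intro h0
  have := congrArg Matrix.det key
  rw [Matrix.det_mul, h0, mul_zero, Matrix.det_diagonal] at this
  exact Finset.prod_ne_zero_iff.2 (fun k _ => hc k) this.symm

theorem card_filter_wheelEigenvalue {m : ℕ} [NeZero m] (p : ℝ → Prop) [DecidablePred p] :
    (Finset.univ.filter fun k => p (wheelEigenvalue m k)).card =
      (if p (hubEigenvalue m (-1)) then 1 else 0) +
        ((Finset.range m).filter fun j => p (wheelEigenvalueSome m j)).card := by
  rw [Finset.card_filter, Fintype.sum_option, Finset.card_filter]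
  congr 1
  obtain ⟨m, rfl⟩ := Nat.exists_eq_succ_of_ne_zero (NeZero.ne m)
  exact Fin.sum_univ_eq_sum_range
    (fun j => if p (wheelEigenvalueSome (m + 1) j) then 1 else 0) (m + 1)

theorem wheelEigenvalueSome_sign {m j : ℕ} (hj : j < m) :
    (0 < wheelEigenvalueSome m j ∧ (j = 0 ∨ m < 3 * j ∧ 3 * j < 2 * m)) ∨
    (wheelEigenvalueSome m j < 0 ∧ 0 < j ∧ (3 * j < m ∨ 2 * m < 3 * j)) ∨
    (wheelEigenvalueSome m j = 0 ∧ 0 < j ∧ (3 * j = m ∨ 3 * j = 2 * m)) := by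
  rcases Nat.eq_zero_or_pos j with rfl | h0
  · left
    simpa [wheelEigenvalueSome] using hubEigenvalue_pos hj
  rw [wheelEigenvalueSome, if_neg h0.ne']
  by_cases h1 : m < 3 * j ∧ 3 * j < 2 * m
  · exact Or.inl ⟨cycleEigenvalue_pos h1.1 h1.2, Or.inr h1⟩
  by_cases h2 : 3 * j < m ∨ 2 * m < 3 * j
  · exact Or.inr (Or.inl ⟨cycleEigenvalue_neg h0 hj h2, h0, h2⟩)
  have h3 : 3 * j = m ∨ 3 * j = 2 * m := by omega
  exact Or.inr (Or.inr ⟨cycleEigenvalue_eq_zero h0 hj h3, h0, h3⟩)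

theorem filter_wheelEigenvalueSome_pos {m : ℕ} (hm : 0 < m) :
    ((Finset.range m).filter fun j => 0 < wheelEigenvalueSome m j) =
      insert 0 (Finset.Ico (m / 3 + 1) ((2 * m + 2) / 3)) := by
  ext j
  simp only [Finset.mem_filter, Finset.mem_range, Finset.mem_insert, Finset.mem_Ico]
  constructor
  · rintro ⟨hj, hp⟩
    rcases wheelEigenvalueSome_sign hj with h | h | h
    · omega
    · exact absurd hp h.1.not_gt
    · exact absurd h.1 hp.ne'
  · intro h
    have hj : j < m := by omega
    rcases wheelEigenvalueSome_sign hj with h' | h' | h'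
    · exact ⟨hj, h'.1⟩
    · omega
    · omega

theorem filter_wheelEigenvalueSome_neg (m : ℕ) :
    ((Finset.range m).filter fun j => wheelEigenvalueSome m j < 0) =
      Finset.Ico 1 ((m + 2) / 3) ∪ Finset.Ico (2 * m / 3 + 1) m := by
  ext j
  simp only [Finset.mem_filter, Finset.mem_range, Finset.mem_union, Finset.mem_Ico]
  constructor
  · rintro ⟨hj, hp⟩
    rcases wheelEigenvalueSome_sign hj with h | h | h
    · exact absurd hp h.1.not_gt
    · omega
    · exact absurd h.1 hp.ne
  · intro h
    have hj : j < m := by omega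
    rcases wheelEigenvalueSome_sign hj with h' | h' | h'
    · omega
    · exact ⟨hj, h'.1⟩
    · omega

theorem filter_wheelEigenvalueSome_zero (m : ℕ) :
    ((Finset.range m).filter fun j => wheelEigenvalueSome m j = 0) =
      if m % 3 = 0 ∧ 0 < m then {m / 3, 2 * m / 3} else ∅ := by
  ext j
  constructor
  · intro hp
    obtain ⟨hj, hp⟩ := Finset.mem_filter.1 hp
    rw [Finset.mem_range] at hj
    rcases wheelEigenvalueSome_sign hj with h | h | h
    · exact absurd hp h.1.ne'
    · exact absurd hp h.1.ne
    · rw [if_pos (by omega)]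
      simp only [Finset.mem_insert, Finset.mem_singleton]
      omega
  · intro h
    split_ifs at h with hm
    · simp only [Finset.mem_insert, Finset.mem_singleton] at h
      have hj : j < m := by omega
      rcases wheelEigenvalueSome_sign hj with h' | h' | h'
      · omega
      · omega
      · simp [hj, h'.1]
    · simp at h

theorem stmt15 (n : ℕ) (h : 5 ≤ n) (hE : (EW n).IsHermitian) :
    if n % 3 = 0 then
      ((Finset.univ.filter fun i => 0 < hE.eigenvalues i).card = (n + 3) / 3 ∧
        (Finset.univ.filter fun i => hE.eigenvalues i < 0).card = (2 * n - 3) / 3 ∧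
        (Finset.univ.filter fun i => hE.eigenvalues i = 0).card = 0)
    else if n % 3 = 1 then
      ((Finset.univ.filter fun i => 0 < hE.eigenvalues i).card = (n - 1) / 3 ∧
        (Finset.univ.filter fun i => hE.eigenvalues i < 0).card = (2 * n - 5) / 3 ∧
        (Finset.univ.filter fun i => hE.eigenvalues i = 0).card = 2)
    else
      ((Finset.univ.filter fun i => 0 < hE.eigenvalues i).card = (n + 1) / 3 ∧
        (Finset.univ.filter fun i => hE.eigenvalues i < 0).card = (2 * n - 1) / 3 ∧
        (Finset.univ.filter fun i => hE.eigenvalues i = 0).card = 0) := by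
  obtain ⟨m, rfl⟩ : ∃ m, n = m + 1 := ⟨n - 1, by omega⟩
  have hm : 4 ≤ m := by omega
  have : NeZero m := ⟨by omega⟩
  have hmap := eigenvalues_map_eq_of_mul_eq_mul_diagonal hE (wheelEquiv m) (wheelEigenvectors m)
    (wheelEigenvalue m) wheelEigenvectors_det_ne_zero (by
      rw [← wheelMatrix_mul_wheelEigenvectors hm, ← reindex_EW]
      rfl)
  have hneg := hubEigenvalue_neg (m := m) (by omega)
  have hcpos : (Finset.univ.filter fun i => 0 < hE.eigenvalues i).card =
      (2 * m + 2) / 3 - m / 3 := by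
    rw [card_filter_comp_eq_of_map_eq hmap fun x => 0 < x,
      card_filter_wheelEigenvalue fun x => 0 < x, if_neg hneg.not_gt,
      filter_wheelEigenvalueSome_pos (by omega), Finset.card_insert_of_notMem (by simp),
      Nat.card_Ico]
    omega
  have hcneg : (Finset.univ.filter fun i => hE.eigenvalues i < 0).card =
      (m + 2) / 3 + (m - 1 - 2 * m / 3) := by
    rw [card_filter_comp_eq_of_map_eq hmap fun x => x < 0,
      card_filter_wheelEigenvalue fun x => x < 0, if_pos hneg,
      filter_wheelEigenvalueSome_neg, Finset.card_union_of_disjoint, Nat.card_Ico, Nat.card_Ico]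
    · omega
    · rw [Finset.disjoint_left]
      intro j
      simp only [Finset.mem_Ico]
      omega
  have hczero : (Finset.univ.filter fun i => hE.eigenvalues i = 0).card =
      if m % 3 = 0 then 2 else 0 := by
    rw [card_filter_comp_eq_of_map_eq hmap fun x => x = 0,
      card_filter_wheelEigenvalue fun x => x = 0, if_neg hneg.ne,
      filter_wheelEigenvalueSome_zero]
    by_cases h3 : m % 3 = 0
    · rw [if_pos ⟨h3, by omega⟩, if_pos h3, Finset.card_pair (by omega)]
    · simp [h3]
  rw [hcpos, hcneg, hczero]
  split_ifs <;> omega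
end
end
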